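/- Let P ⊆ ℝ^d be a full-dimensional IDP (0,1)-polytope which is nearly Gorenstein. Then there exist a permutation σ of the coordinates of ℝ^d, positive integers d_1, …, d_s with d_1 + ⋯ + d_s = d, and Gorenstein full-dimensional (0,1)-polytopes P_i ⊆ ℝ^{d_i} (i = 1, …, s) such that the image of P under σ equals the direct product P_1 × ⋯ × P_s; in particular, P is a Minkowski sum of Gorenstein lattice polytopes. -/

import Mathlib

open Set Pointwise

/-- The set of lattice points of `ℝ^d`. -/
def latticePoints (d : ℕ) : Set (Fin d → ℝ) :=
  {x | ∀ i, ∃ z : ℤ, x i = (z : ℝ)}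

/-- A lattice polytope: the convex hull of a finite set of lattice points. -/
def IsLatticePolytope {d : ℕ} (P : Set (Fin d → ℝ)) : Prop :=
  ∃ V : Finset (Fin d → ℝ), (V : Set (Fin d → ℝ)) ⊆ latticePoints d ∧
    P = convexHull ℝ (V : Set (Fin d → ℝ))

/-- The natural pairing of an integral linear functional with a point of `ℝ^d`. -/
def pairing {d : ℕ} (n : Fin d → ℤ) (x : Fin d → ℝ) : ℝ :=
  ∑ i, (n i : ℝ) * x i

/-- `P = {x | n_F(x) ≥ -h_F}` is an irredundant presentation with primitive
integral inner normals, i.e. the facet presentation of `P`. -/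
def IsFacetPresentation {d m : ℕ} (P : Set (Fin d → ℝ))
    (n : Fin m → Fin d → ℤ) (h : Fin m → ℤ) : Prop :=
  P = {x | ∀ i, pairing (n i) x ≥ -(h i : ℝ)} ∧
  (∀ i, Finset.univ.gcd (n i) = 1) ∧
  (∀ i, ∃ x : Fin d → ℝ, pairing (n i) x < -(h i : ℝ) ∧
    ∀ j, j ≠ i → pairing (n j) x ≥ -(h j : ℝ))

/-- `a` is the codegree of `P`: the least `k ≥ 1` such that `int(kP)` contains
a lattice point. -/
def IsCodegree {d : ℕ} (P : Set (Fin d → ℝ)) (a : ℕ) : Prop :=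
  1 ≤ a ∧ (interior ((a : ℝ) • P) ∩ latticePoints d).Nonempty ∧
    ∀ k : ℕ, 1 ≤ k → (interior ((k : ℝ) • P) ∩ latticePoints d).Nonempty → a ≤ k

/-- The floor polytope `⌊R⌋ = conv(int(R) ∩ ℤ^d)`. -/
def floorPoly {d : ℕ} (R : Set (Fin d → ℝ)) : Set (Fin d → ℝ) :=
  convexHull ℝ (interior R ∩ latticePoints d)

/-- The remainder polytope `{P} = conv{x ∈ ℤ^d | n_F(x) ≥ (a-1)h_F - 1}`,
defined in terms of the facet presentation data and the codegree `a`. -/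
def remPoly {d m : ℕ} (n : Fin m → Fin d → ℤ) (h : Fin m → ℤ) (a : ℕ) :
    Set (Fin d → ℝ) :=
  convexHull ℝ {x | x ∈ latticePoints d ∧
    ∀ i, pairing (n i) x ≥ ((a : ℝ) - 1) * (h i : ℝ) - 1}

/-- The cone `C_P ⊆ ℝ^d × ℝ` over `P`, in terms of the facet presentation. -/
def coneOver {d m : ℕ} (n : Fin m → Fin d → ℤ) (h : Fin m → ℤ) :
    Set ((Fin d → ℝ) × ℝ) :=
  {p | ∀ i, pairing (n i) p.1 ≥ -(p.2 * (h i : ℝ))}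

/-- The interior `int(C_P)` of the cone over `P`. -/
def intCone {d m : ℕ} (n : Fin m → Fin d → ℤ) (h : Fin m → ℤ) :
    Set ((Fin d → ℝ) × ℝ) :=
  {p | ∀ i, pairing (n i) p.1 > -(p.2 * (h i : ℝ))}

/-- The anticanonical set `ant(C_P)` of the cone over `P`. -/
def antCone {d m : ℕ} (n : Fin m → Fin d → ℤ) (h : Fin m → ℤ) :
    Set ((Fin d → ℝ) × ℝ) :=
  {p | ∀ i, pairing (n i) p.1 ≥ -(p.2 * (h i : ℝ)) - 1}

/-- Lattice points of `ℝ^d × ℝ = ℝ^{d+1}`. -/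
def latticePairs (d : ℕ) : Set ((Fin d → ℝ) × ℝ) :=
  {p | p.1 ∈ latticePoints d ∧ ∃ z : ℤ, p.2 = (z : ℝ)}

/-- The nearly Gorenstein condition with respect to a given facet presentation:
`(C_P ∩ ℤ^{d+1}) \ {0} ⊆ (int(C_P) ∩ ℤ^{d+1}) + (ant(C_P) ∩ ℤ^{d+1})`. -/
def NGIncl {d m : ℕ} (n : Fin m → Fin d → ℤ) (h : Fin m → ℤ) : Prop :=
  (coneOver n h ∩ latticePairs d) \ {(0 : (Fin d → ℝ) × ℝ)} ⊆
    (intCone n h ∩ latticePairs d) + (antCone n h ∩ latticePairs d)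

/-- A full-dimensional lattice polytope is nearly Gorenstein if the nearly
Gorenstein inclusion holds for its facet presentation. -/
def NearlyGorenstein {d : ℕ} (P : Set (Fin d → ℝ)) : Prop :=
  ∃ (m : ℕ) (n : Fin m → Fin d → ℤ) (h : Fin m → ℤ),
    IsFacetPresentation P n h ∧ NGIncl n h

/-- The polar dual `Q* = {y | y(x) ≥ -1 for all x ∈ Q}`. -/
def polarDual {d : ℕ} (Q : Set (Fin d → ℝ)) : Set (Fin d → ℝ) :=
  {y | ∀ x ∈ Q, (∑ i, y i * x i) ≥ -1}

/-- A reflexive polytope: a lattice polytope with `0` in its interior whose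
polar dual is again a lattice polytope. -/
def IsReflexive {d : ℕ} (Q : Set (Fin d → ℝ)) : Prop :=
  IsLatticePolytope Q ∧ (0 : Fin d → ℝ) ∈ interior Q ∧
    IsLatticePolytope (polarDual Q)

/-- A Gorenstein polytope: some dilate `kP`, translated by a lattice vector,
is reflexive. -/
def IsGorenstein {d : ℕ} (P : Set (Fin d → ℝ)) : Prop :=
  ∃ (k : ℕ) (w : Fin d → ℝ), 1 ≤ k ∧ w ∈ latticePoints d ∧
    IsReflexive ((fun x => x - w) '' ((k : ℝ) • P))

/-- The integer decomposition property. -/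
def IsIDP {d : ℕ} (P : Set (Fin d → ℝ)) : Prop :=
  ∀ k : ℕ, 1 ≤ k → ∀ x ∈ ((k : ℝ) • P) ∩ latticePoints d,
    ∃ y : Fin k → Fin d → ℝ, (∀ j, y j ∈ P ∩ latticePoints d) ∧ x = ∑ j, y j

/-- Minkowski indecomposability of a lattice polytope. -/
def IsIndecomposable {d : ℕ} (P : Set (Fin d → ℝ)) : Prop :=
  (¬ ∃ p : Fin d → ℝ, P = {p}) ∧
  ∀ P₁ P₂ : Set (Fin d → ℝ), IsLatticePolytope P₁ → IsLatticePolytope P₂ →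
    P = P₁ + P₂ → (∃ p, P₁ = {p}) ∨ (∃ p, P₂ = {p})

/-- A `(0,1)`-polytope: the convex hull of a set of `(0,1)`-vectors. -/
def Is01Polytope {d : ℕ} (P : Set (Fin d → ℝ)) : Prop :=
  ∃ V : Finset (Fin d → ℝ), (∀ v ∈ V, ∀ i, v i = 0 ∨ v i = 1) ∧
    P = convexHull ℝ (V : Set (Fin d → ℝ))


/-- The linear functional `x ↦ n(x)`. -/
def pairingLin {d : ℕ} (n : Fin d → ℤ) : (Fin d → ℝ) →ₗ[ℝ] ℝ :=
  ∑ i, (n i : ℝ) • LinearMap.proj i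

lemma pairing_eq_pairingLin {d : ℕ} (n : Fin d → ℤ) (x : Fin d → ℝ) :
    pairing n x = pairingLin n x := by
  simp [pairing, pairingLin]

lemma add_mem_latticePoints {d : ℕ} {x y : Fin d → ℝ} (hx : x ∈ latticePoints d)
    (hy : y ∈ latticePoints d) : x + y ∈ latticePoints d := by
  intro i
  obtain ⟨a, ha⟩ := hx i
  obtain ⟨b, hb⟩ := hy i
  exact ⟨a + b, by simp [ha, hb]⟩

lemma neg_mem_latticePoints {d : ℕ} {x : Fin d → ℝ} (hx : x ∈ latticePoints d) :
    -x ∈ latticePoints d := by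
  intro i
  obtain ⟨a, ha⟩ := hx i
  exact ⟨-a, by simp [ha]⟩

lemma mem_latticePoints_of_zero_one {d : ℕ} {x : Fin d → ℝ}
    (hx : ∀ i, x i = 0 ∨ x i = 1) : x ∈ latticePoints d := by
  intro i
  rcases hx i with h | h
  · exact ⟨0, by simp [h]⟩
  · exact ⟨1, by simp [h]⟩

lemma pairing_mem_int {d : ℕ} (n : Fin d → ℤ) {x : Fin d → ℝ} (hx : x ∈ latticePoints d) :
    ∃ z : ℤ, pairing n x = z := by
  choose z hz using hx
  exact ⟨∑ i, n i * z i, by simp [pairing, hz]⟩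

/-- `P` splits along `I` if it is closed under replacing the coordinates in `I` of one of its
points by those of another one, i.e. if it is the product of its projections to the
coordinates in `I` and to those outside `I`. -/
def SplitsAlong {ι : Type*} (P : Set (ι → ℝ)) (I : Set ι) : Prop :=
  ∀ x ∈ P, ∀ y ∈ P, ∀ z : ι → ℝ, (∀ i ∈ I, z i = x i) → (∀ i ∉ I, z i = y i) → z ∈ P

lemma splitsAlong_convexHull {ι : Type*} {V : Set (ι → ℝ)} {I : Set ι}
    (hV : ∀ x ∈ V, ∀ y ∈ V, ∀ z : ι → ℝ, (∀ i ∈ I, z i = x i) → (∀ i ∉ I, z i = y i) →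
      z ∈ convexHull ℝ V) : SplitsAlong (convexHull ℝ V) I := by
  classical
  intro x hx y hy z hzx hzy
  let f : ((ι → ℝ) × (ι → ℝ)) →ₗ[ℝ] (ι → ℝ) := LinearMap.pi fun i =>
    if i ∈ I then (LinearMap.proj i).comp (LinearMap.fst ℝ _ _)
    else (LinearMap.proj i).comp (LinearMap.snd ℝ _ _)
  have hf : ∀ p i, f p i = if i ∈ I then p.1 i else p.2 i := by
    intro p i
    by_cases hi : i ∈ I <;> simp [f, hi]
  have hsub : convexHull ℝ (V ×ˢ V) ⊆ f ⁻¹' convexHull ℝ V := by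
    refine convexHull_min ?_ ((convex_convexHull ℝ V).linear_preimage f)
    rintro ⟨a, b⟩ ⟨ha, hb⟩
    exact hV a ha b hb _ (fun i hi => by simp [hf, hi]) (fun i hi => by simp [hf, hi])
  rw [convexHull_prod] at hsub
  have hz : z = f (x, y) := by
    funext i
    by_cases hi : i ∈ I
    · simp [hf, hi, hzx]
    · simp [hf, hi, hzy]
  rw [hz]
  exact hsub (mk_mem_prod hx hy)

lemma mem_Icc_of_mem_convexHull {ι : Type*} {V : Set (ι → ℝ)}
    (h01 : ∀ v ∈ V, ∀ i, v i = 0 ∨ v i = 1) {x : ι → ℝ} (hx : x ∈ convexHull ℝ V) (i : ι) :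
    0 ≤ x i ∧ x i ≤ 1 := by
  have : convexHull ℝ V ⊆ Icc 0 1 := by
    refine convexHull_min (fun v hv => ⟨fun i => ?_, fun i => ?_⟩) (convex_Icc _ _) <;>
      rcases h01 v hv i with h | h <;> simp [h]
  exact ⟨(this hx).1 i, (this hx).2 i⟩

section Recession

variable {d : ℕ} {κ : Type*} {n : κ → Fin d → ℤ} {h : κ → ℤ} {V : Set (Fin d → ℝ)}

lemma eq_zero_of_pairing_nonneg (h01 : ∀ v ∈ V, ∀ i, v i = 0 ∨ v i = 1) (hne : V.Nonempty)
    (hP : convexHull ℝ V = {x | ∀ F, pairing (n F) x ≥ -(h F : ℝ)})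
    {z : Fin d → ℝ} (hz : ∀ F, 0 ≤ pairing (n F) z) : z = 0 := by
  obtain ⟨p, hp⟩ := hne
  have key : ∀ t : ℝ, 0 ≤ t → ∀ i, 0 ≤ p i + t * z i ∧ p i + t * z i ≤ 1 := by
    intro t ht i
    have hmem : p + t • z ∈ convexHull ℝ V := by
      have hpP := subset_convexHull ℝ V hp
      rw [hP] at hpP ⊢
      intro F
      have h1 := hpP F
      have h2 := mul_nonneg ht (hz F)
      rw [pairing_eq_pairingLin] at *
      simp only [map_add, map_smul, smul_eq_mul]
      linarith
    simpa using mem_Icc_of_mem_convexHull h01 hmem i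
  funext i
  by_contra hi
  have hpos : 0 < |z i| := abs_pos.mpr hi
  have h0 := key 0 le_rfl i
  have h1 := key (2 / |z i|) (by positivity) i
  rcases abs_cases (z i) with ⟨ha, hb⟩ | ⟨ha, hb⟩ <;> rw [ha] at h1 hpos
  · have : 2 / z i * z i = 2 := by field_simp
    linarith
  · have : 2 / -z i * z i = -2 := by rw [div_neg, neg_mul, div_mul_cancel₀ _ hb.ne]
    linarith

lemma nonempty_facets (hd : 0 < d) (h01 : ∀ v ∈ V, ∀ i, v i = 0 ∨ v i = 1) (hne : V.Nonempty)
    (hP : convexHull ℝ V = {x | ∀ F, pairing (n F) x ≥ -(h F : ℝ)}) : Nonempty κ := by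
  by_contra hκ
  rw [not_nonempty_iff] at hκ
  have := eq_zero_of_pairing_nonneg h01 hne hP (z := 1) (fun F => isEmptyElim F)
  exact one_ne_zero (congrFun this ⟨0, hd⟩)

end Recession

/-- If every vertex of `P` decomposes as in the nearly Gorenstein condition and `P` is not a
nontrivial product, then some dilate of `P` has a lattice point at height one over all
facets. -/
lemma exists_height_one_point {d : ℕ} {κ : Type*} {n : κ → Fin d → ℤ} {h : κ → ℤ}
    {V : Set (Fin d → ℝ)} (hd : 0 < d)
    (h01 : ∀ v ∈ V, ∀ i, v i = 0 ∨ v i = 1) (hne : V.Nonempty)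
    (hP : convexHull ℝ V = {x | ∀ F, pairing (n F) x ≥ -(h F : ℝ)})
    (htight : ∀ F, ∃ v ∈ V, pairing (n F) v = -(h F : ℝ))
    (hdec : ∀ v ∈ V, ∃ k : ℤ, ∃ u ∈ latticePoints d, ∃ w ∈ latticePoints d, v = u + w ∧
      (∀ F, -((k : ℝ) * h F) + 1 ≤ pairing (n F) u) ∧
      (∀ F, ((k : ℝ) - 1) * h F - 1 ≤ pairing (n F) w))
    (hind : ∀ I : Set (Fin d), SplitsAlong (convexHull ℝ V) I → I = ∅ ∨ I = univ) :
    ∃ a : ℕ, 1 ≤ a ∧ ∃ u ∈ latticePoints d, ∀ F, pairing (n F) u = -((a : ℝ) * h F) + 1 := by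
  classical
  have hrec := fun z => eq_zero_of_pairing_nonneg (z := z) h01 hne hP
  obtain ⟨F₀⟩ := nonempty_facets hd h01 hne hP
  obtain ⟨p, hp⟩ := hne
  have hpP : ∀ F, pairing (n F) p ≥ -(h F : ℝ) := by
    have := subset_convexHull ℝ V hp
    rwa [hP] at this
  simp only [pairing_eq_pairingLin] at *
  let S : ℤ → Set (Fin d → ℝ) := fun k =>
    {u | u ∈ latticePoints d ∧ ∀ F, -((k : ℝ) * h F) + 1 ≤ pairingLin (n F) u}
  have hSpos : ∀ k, (S k).Nonempty → 1 ≤ k := by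
    rintro k ⟨u, -, hu⟩
    by_contra! hk
    have hk' : (k : ℝ) ≤ 0 := by exact_mod_cast (by omega : k ≤ 0)
    have hF : ∀ F, 1 ≤ pairingLin (n F) (u + (-(k : ℝ)) • p) := by
      intro F
      have h1 := hu F
      have h2 := mul_le_mul_of_nonneg_left (hpP F) (neg_nonneg.mpr hk')
      simp only [map_add, map_smul, smul_eq_mul]
      linarith
    have h0 := hrec _ (fun F => zero_le_one.trans (hF F))
    have h1 := hF F₀
    rw [h0, map_zero] at h1
    linarith
  have hex : ∃ a : ℕ, (S a).Nonempty := by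
    obtain ⟨k, u, hu, -, -, -, hku, -⟩ := hdec p hp
    have hS : (S k).Nonempty := ⟨u, hu, hku⟩
    lift k to ℕ using by linarith [hSpos k hS]
    exact ⟨k, hS⟩
  obtain ⟨a, ⟨u₀, hu₀, hau₀⟩, hmin⟩ :
      ∃ a : ℕ, (S a).Nonempty ∧ ∀ k : ℤ, (S k).Nonempty → a ≤ k := by
    refine ⟨Nat.find hex, Nat.find_spec hex, fun k hk => ?_⟩
    lift k to ℕ using by linarith [hSpos k hk]
    exact_mod_cast Nat.find_min' hex hk
  have ha : 1 ≤ a := by exact_mod_cast hSpos a ⟨u₀, hu₀, hau₀⟩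
  refine ⟨a, ha, ?_⟩
  simp only [Int.cast_natCast] at hau₀
  by_cases hlarge : ∃ k : ℤ, (a : ℤ) < k ∧ ∃ w, ∀ F, ((k : ℝ) - 1) * h F - 1 ≤ pairingLin (n F) w
  · obtain ⟨k, hk, w, hw⟩ := hlarge
    have hk' : (0 : ℝ) ≤ k - 1 - a := by
      have : ((a : ℤ) : ℝ) + 1 ≤ k := by exact_mod_cast hk
      push_cast at this
      linarith
    have hmul : ∀ F, (k - 1 - a : ℝ) * -(h F : ℝ) ≤ (k - 1 - a) * pairingLin (n F) p := fun F =>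
      mul_le_mul_of_nonneg_left (hpP F) hk'
    have hz : u₀ + w + ((k : ℝ) - 1 - a) • p = 0 := by
      refine hrec _ fun F => ?_
      have h1 := hau₀ F
      have h2 := hw F
      have h3 := hmul F
      simp only [map_add, map_smul, smul_eq_mul]
      linarith
    refine ⟨u₀, hu₀, fun F => le_antisymm ?_ (hau₀ F)⟩
    have h0 := congrArg (pairingLin (n F)) hz
    simp only [map_add, map_smul, smul_eq_mul, map_zero] at h0
    have h2 := hw F
    have h3 := hmul F
    linarith
  let T : Set (Fin d → ℝ) :=
    {w | w ∈ latticePoints d ∧ ∀ F, ((a : ℝ) - 1) * h F - 1 ≤ pairingLin (n F) w}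
  have hdec' : ∀ v ∈ V, ∃ u ∈ S a, ∃ w ∈ T, v = u + w := by
    intro v hv
    obtain ⟨k, u, hu, w, hw, hvuw, hku, hkw⟩ := hdec v hv
    have h1 : (a : ℤ) ≤ k := hmin k ⟨u, hu, hku⟩
    have h2 : k ≤ a := by
      by_contra! hlt
      exact hlarge ⟨k, hlt, w, hkw⟩
    obtain rfl : k = a := le_antisymm h2 h1
    exact ⟨u, ⟨hu, hku⟩, w, ⟨hw, by simpa using hkw⟩, hvuw⟩
  have hsum : ∀ u ∈ S a, ∀ w ∈ T, u + w ∈ convexHull ℝ V := by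
    rintro u ⟨-, hu⟩ w ⟨-, hw⟩
    rw [hP]
    intro F
    have h1 := hu F
    have h2 := hw F
    simp only [map_add]
    push_cast at h1
    linarith
  let I : Set (Fin d) := {i | ∃ u ∈ S a, ∃ u' ∈ S a, u i < u' i}
  have hTI : ∀ i ∈ I, ∀ w ∈ T, ∀ w' ∈ T, w i ≤ w' i := by
    rintro i ⟨u, hu, u', hu', hlt⟩ w hw w' hw'
    have h1 := (mem_Icc_of_mem_convexHull h01 (hsum u hu w' hw') i).1
    have h2 := (mem_Icc_of_mem_convexHull h01 (hsum u' hu' w hw) i).2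
    obtain ⟨z, hz⟩ := hu.1 i
    obtain ⟨z', hz'⟩ := hu'.1 i
    have h3 : u i + 1 ≤ u' i := by
      rw [hz, hz'] at hlt ⊢
      exact_mod_cast hlt
    simp only [Pi.add_apply] at h1 h2
    linarith
  have hSI : ∀ i ∉ I, ∀ u ∈ S a, ∀ u' ∈ S a, u i ≤ u' i := by
    intro i hi u hu u' hu'
    by_contra! hlt
    exact hi ⟨u', hu', u, hu, hlt⟩
  have hsplit : SplitsAlong (convexHull ℝ V) I := by
    refine splitsAlong_convexHull fun x hx y hy z hzx hzy => ?_
    obtain ⟨u, hu, w, hw, rfl⟩ := hdec' x hx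
    obtain ⟨u', hu', w', hw', rfl⟩ := hdec' y hy
    have hz : z = u + w' := by
      funext i
      by_cases hi : i ∈ I
      · simp [hzx i hi, le_antisymm (hTI i hi w hw w' hw') (hTI i hi w' hw' w hw)]
      · simp [hzy i hi, le_antisymm (hSI i hi u hu u' hu') (hSI i hi u' hu' u hu)]
    rw [hz]
    exact hsum u hu w' hw'
  rcases hind I hsplit with hI | hI
  · refine ⟨u₀, hu₀, fun F => le_antisymm ?_ (hau₀ F)⟩
    obtain ⟨v, hv, hFv⟩ := htight F
    obtain ⟨u, hu, w, hw, rfl⟩ := hdec' v hv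
    have hS₀ : u₀ ∈ S a := ⟨hu₀, by simpa using hau₀⟩
    have huu : u = u₀ := funext fun i =>
      le_antisymm (hSI i (by simp [hI]) u hu u₀ hS₀) (hSI i (by simp [hI]) u₀ hS₀ u hu)
    have h2 := hw.2 F
    rw [map_add, huu] at hFv
    linarith
  · exfalso
    obtain ⟨-, -, w₀, hw₀, -⟩ := hdec' p hp
    have hneg : -w₀ ∈ S (a - 1) := by
      refine ⟨neg_mem_latticePoints hw₀.1, fun F => ?_⟩
      obtain ⟨v, hv, hFv⟩ := htight F
      obtain ⟨u, hu, w, hw, rfl⟩ := hdec' v hv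
      have hww : w = w₀ := funext fun i =>
        le_antisymm (hTI i (by simp [hI]) w hw w₀ hw₀) (hTI i (by simp [hI]) w₀ hw₀ w hw)
      have h1 := hu.2 F
      rw [map_add, hww] at hFv
      rw [map_neg]
      push_cast at h1 ⊢
      linarith
    have := hmin _ ⟨_, hneg⟩
    omega

/-- A bounded polyhedron given by integral inequalities `n_F(x) ≥ -1` has the convex hull of
the `n_F` as its polar dual. -/
lemma polarDual_eq_convexHull {d : ℕ} {κ : Type*} [Finite κ] [Nonempty κ] {n : κ → Fin d → ℤ}
    (hrec : ∀ z : Fin d → ℝ, (∀ F, 0 ≤ pairing (n F) z) → z = 0) :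
    polarDual {x | ∀ F, -1 ≤ pairing (n F) x} =
      convexHull ℝ (range fun F i => (n F i : ℝ)) := by
  refine Subset.antisymm (fun y hy => ?_) (convexHull_min ?_ ?_)
  · by_contra hyn
    have hcl : IsClosed (convexHull ℝ (range fun F i => (n F i : ℝ))) :=
      (finite_range _).isClosed_convexHull ℝ
    obtain ⟨f, c, hfy, hfc⟩ := geometric_hahn_banach_point_closed (convex_convexHull ℝ _) hcl hyn
    let x : Fin d → ℝ := fun i => f (Pi.single i 1)
    have hf : ∀ z : Fin d → ℝ, f z = ∑ i, z i * x i := by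
      intro z
      conv_lhs => rw [← Finset.univ_sum_single z]
      rw [map_sum]
      refine Finset.sum_congr rfl fun i _ => ?_
      have : (Pi.single i (z i) : Fin d → ℝ) = z i • Pi.single i 1 := by
        rw [← Pi.single_smul]; simp
      rw [this, map_smul, smul_eq_mul]
    have hFx : ∀ F, c < pairing (n F) x := by
      intro F
      have := hfc _ (subset_convexHull ℝ _ (mem_range_self F))
      rwa [hf] at this
    rw [hf] at hfy
    rcases lt_or_ge c 0 with hc | hc
    · have hmem := hy ((-c)⁻¹ • x) (fun F => by
        have h1 : c < pairingLin (n F) x := by rw [← pairing_eq_pairingLin]; exact hFx F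
        rw [pairing_eq_pairingLin, map_smul, smul_eq_mul, inv_mul_eq_div,
          le_div_iff₀ (by linarith)]
        linarith)
      have : ∑ i, y i * ((-c)⁻¹ • x) i = (-c)⁻¹ * ∑ i, y i * x i := by
        rw [Finset.mul_sum]
        refine Finset.sum_congr rfl fun i _ => ?_
        simp only [Pi.smul_apply, smul_eq_mul]
        ring
      rw [this, inv_mul_eq_div, ge_iff_le, le_div_iff₀ (by linarith)] at hmem
      linarith
    · have hx := hrec x fun F => hc.trans (hFx F).le
      obtain ⟨F⟩ := ‹Nonempty κ›
      have := hFx F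
      rw [hx, pairing_eq_pairingLin, map_zero] at this
      linarith
  · rintro _ ⟨F, rfl⟩ x hx
    exact hx F
  · intro y hy y' hy' s t hs ht hst x hx
    have h1 := mul_le_mul_of_nonneg_left (hy x hx) hs
    have h2 := mul_le_mul_of_nonneg_left (hy' x hx) ht
    have : ∑ i, (s • y + t • y') i * x i = s * ∑ i, y i * x i + t * ∑ i, y' i * x i := by
      rw [Finset.mul_sum, Finset.mul_sum, ← Finset.sum_add_distrib]
      refine Finset.sum_congr rfl fun i _ => ?_
      simp only [Pi.add_apply, Pi.smul_apply, smul_eq_mul]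
      ring
    rw [this]
    linarith

lemma isGorenstein_of_height_one_point {d : ℕ} {κ : Type*} [Finite κ] {n : κ → Fin d → ℤ}
    {h : κ → ℤ} {V : Finset (Fin d → ℝ)} (hd : 0 < d)
    (h01 : ∀ v ∈ V, ∀ i, v i = 0 ∨ v i = 1) (hne : V.Nonempty)
    (hP : convexHull ℝ (V : Set (Fin d → ℝ)) = {x | ∀ F, pairing (n F) x ≥ -(h F : ℝ)})
    {a : ℕ} (ha : 1 ≤ a) {u : Fin d → ℝ} (hu : u ∈ latticePoints d)
    (hheight : ∀ F, pairing (n F) u = -((a : ℝ) * h F) + 1) :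
    IsGorenstein (convexHull ℝ (V : Set (Fin d → ℝ))) := by
  classical
  have hrec := fun z => eq_zero_of_pairing_nonneg (z := z) h01 hne hP
  have := nonempty_facets hd h01 hne hP
  have ha' : (0 : ℝ) < a := by exact_mod_cast ha
  have hQ : (fun x => x - u) '' ((a : ℝ) • convexHull ℝ (V : Set (Fin d → ℝ))) =
      {x | ∀ F, -1 ≤ pairing (n F) x} := by
    ext x
    rw [image_sub_right, mem_preimage, mem_smul_set_iff_inv_smul_mem₀ ha'.ne', hP]
    refine forall_congr' fun F => ?_
    have h1 := hheight F
    rw [pairing_eq_pairingLin] at *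
    rw [map_smul, map_add, h1, smul_eq_mul, pairing_eq_pairingLin, inv_mul_eq_div, ge_iff_le,
      le_div_iff₀ ha']
    constructor <;> intro <;> linarith
  refine ⟨a, u, ha, hu, ?_, ?_, ?_⟩
  · refine ⟨V.image fun v => (a : ℝ) • v - u, ?_, ?_⟩
    · intro x hx
      obtain ⟨v, hv, rfl⟩ := Finset.mem_image.mp hx
      rw [sub_eq_add_neg]
      refine add_mem_latticePoints (fun i => ?_) (neg_mem_latticePoints hu)
      obtain ⟨z, hz⟩ := mem_latticePoints_of_zero_one (h01 v hv) i
      exact ⟨a * z, by simp [hz]⟩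
    · rw [← convexHull_smul, Finset.coe_image]
      have h1 : ∀ A : Set (Fin d → ℝ), (fun x => x - u) '' A = A + {-u} := by
        intro A
        simp [sub_eq_add_neg]
      rw [h1, ← convexHull_singleton (𝕜 := ℝ) (-u), ← convexHull_add, ← h1,
        ← image_smul, image_image]
  · rw [hQ]
    refine mem_interior.mpr ⟨{x | ∀ F, -1 < pairing (n F) x}, fun x hx F => (hx F).le, ?_, ?_⟩
    · simp only [ofPred_forall]
      refine isOpen_iInter_of_finite fun F => isOpen_lt continuous_const ?_
      unfold pairing
      fun_prop
    · intro F
      simp [pairing]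
  · rw [hQ, polarDual_eq_convexHull hrec]
    refine ⟨(finite_range fun F i => (n F i : ℝ)).toFinset, ?_, by simp⟩
    rw [Finite.coe_toFinset]
    rintro _ ⟨F, rfl⟩ i
    exact ⟨n F i, rfl⟩

section Facets

variable {d m : ℕ} {P : Set (Fin d → ℝ)} {n : Fin m → Fin d → ℤ} {h : Fin m → ℤ}

lemma IsFacetPresentation.exists_normal_ne_zero (hF : IsFacetPresentation P n h) (F : Fin m) :
    ∃ i, n F i ≠ 0 := by
  by_contra! hzero
  have h1 := hF.2.1 F
  rw [Finset.gcd_eq_zero_iff.mpr fun i _ => hzero i] at h1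
  exact zero_ne_one h1

lemma pairing_single {d : ℕ} (n : Fin d → ℤ) (i : Fin d) (c : ℝ) :
    pairing n (Pi.single i c) = n i * c := by
  simp [pairing, Pi.single_apply]

lemma IsFacetPresentation.lt_pairing_of_mem_interior (hF : IsFacetPresentation P n h)
    {p : Fin d → ℝ} (hp : p ∈ interior P) (F : Fin m) : -(h F : ℝ) < pairing (n F) p := by
  obtain ⟨i, hi⟩ := hF.exists_normal_ne_zero F
  have hi' : (n F i : ℝ) ≠ 0 := by exact_mod_cast hi
  have hsurj : Function.Surjective (pairingLin (n F)) := by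
    intro c
    refine ⟨Pi.single i (c / n F i), ?_⟩
    rw [← pairing_eq_pairingLin, pairing_single]
    field_simp
  have hopen := LinearMap.isOpenMap_of_finiteDimensional _ hsurj
  have hsub : pairingLin (n F) '' P ⊆ Ici (-(h F : ℝ)) := by
    rintro _ ⟨x, hx, rfl⟩
    rw [hF.1] at hx
    rw [← pairing_eq_pairingLin]
    exact hx F
  have := interior_mono hsub (hopen.image_interior_subset P (mem_image_of_mem _ hp))
  rw [interior_Ici, ← pairing_eq_pairingLin] at this
  exact this

/-- Every facet has a point that lies on no other facet. -/
lemma IsFacetPresentation.exists_relint_point (hF : IsFacetPresentation P n h)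
    (hfull : (interior P).Nonempty) (F : Fin m) :
    ∃ q, pairing (n F) q = -(h F : ℝ) ∧ ∀ G, G ≠ F → -(h G : ℝ) < pairing (n G) q := by
  obtain ⟨p, hp⟩ := hfull
  obtain ⟨x, hxF, hx⟩ := hF.2.2 F
  have hp' := hF.lt_pairing_of_mem_interior hp
  have hpF := hp' F
  have hden : 0 < pairing (n F) p - pairing (n F) x := by linarith
  set t : ℝ := (-(h F : ℝ) - pairing (n F) x) / (pairing (n F) p - pairing (n F) x) with ht
  have ht0 : 0 < t := div_pos (by linarith) hden
  have ht1 : t < 1 := (div_lt_one hden).mpr (by linarith)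
  have hval : ∀ G, pairing (n G) (x + t • (p - x)) =
      pairing (n G) x + t * (pairing (n G) p - pairing (n G) x) := by
    intro G
    simp [pairing_eq_pairingLin]
  refine ⟨x + t • (p - x), ?_, fun G hG => ?_⟩
  · rw [hval, ht, div_mul_cancel₀ _ hden.ne']
    ring
  · rw [hval]
    have h1 := hx G hG
    have h2 := mul_lt_mul_of_pos_left (hp' G) ht0
    have h3 := mul_le_mul_of_nonneg_left h1 (by linarith : 0 ≤ 1 - t)
    linarith

/-- If `P` is a product, then each facet normal lives on one of the factors. -/
lemma IsFacetPresentation.normal_eq_zero_of_splitsAlong (hF : IsFacetPresentation P n h)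
    (hfull : (interior P).Nonempty) {I : Set (Fin d)} (hI : SplitsAlong P I) {F : Fin m}
    {i j : Fin d} (hi : i ∈ I) (hj : j ∉ I) (hni : n F i ≠ 0) : n F j = 0 := by
  by_contra hnj
  obtain ⟨q, hqF, hq⟩ := hF.exists_relint_point hfull F
  have hni' : (n F i : ℝ) ≠ 0 := by exact_mod_cast hni
  have hnj' : (n F j : ℝ) ≠ 0 := by exact_mod_cast hnj
  set v : Fin d → ℝ := Pi.single i (n F i : ℝ)⁻¹ with hv
  set v' : Fin d → ℝ := Pi.single j (n F j : ℝ)⁻¹ with hv'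
  have hFv : pairing (n F) v = 1 := by rw [hv, pairing_single, mul_inv_cancel₀ hni']
  have hFv' : pairing (n F) v' = 1 := by rw [hv', pairing_single, mul_inv_cancel₀ hnj']
  have hev : ∀ᶠ t : ℝ in nhds 0, ∀ G, G ≠ F → -(h G : ℝ) < pairing (n G) (q + t • (v - v')) := by
    rw [Filter.eventually_all]
    intro G
    by_cases hG : G = F
    · simp [hG]
    · have hcont : Continuous fun t : ℝ => pairing (n G) (q + t • (v - v')) := by
        unfold pairing
        fun_prop
      have := (hcont.tendsto 0).eventually_const_lt (by simpa using hq G hG)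
      filter_upwards [this] with t ht _ using ht
  obtain ⟨ε, hε, hball⟩ := Metric.eventually_nhds_iff.mp hev
  have hmem : ∀ t : ℝ, |t| < ε → q + t • (v - v') ∈ P := by
    intro t ht
    rw [hF.1]
    intro G
    by_cases hG : G = F
    · subst hG
      rw [pairing_eq_pairingLin] at *
      simp [hFv, hFv', hqF]
    · exact (hball (by simpa using ht) G hG).le
  have hε2 : |ε / 2| < ε := by rw [abs_of_pos (by positivity)]; linarith
  have hz : q - (ε / 2) • v - (ε / 2) • v' ∈ P := by
    refine hI _ (hmem (-(ε / 2)) (by rwa [abs_neg])) _ (hmem (ε / 2) hε2) _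
      (fun k hk => ?_) (fun k hk => ?_)
    · have : v' k = 0 := Pi.single_eq_of_ne (by rintro rfl; exact hj hk) _
      simp only [Pi.sub_apply, Pi.add_apply, Pi.smul_apply, smul_eq_mul, this]
      ring
    · have : v k = 0 := Pi.single_eq_of_ne (by rintro rfl; exact hk hi) _
      simp only [Pi.sub_apply, Pi.add_apply, Pi.smul_apply, smul_eq_mul, this]
      ring
  rw [hF.1] at hz
  have h1 := hz F
  rw [pairing_eq_pairingLin] at *
  simp only [map_sub, map_smul, smul_eq_mul, hFv, hFv', hqF] at h1
  linarith

lemma IsFacetPresentation.exists_vertex_mem_facet {V : Set (Fin d → ℝ)}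
    (hF : IsFacetPresentation (convexHull ℝ V) n h)
    (hfull : (interior (convexHull ℝ V)).Nonempty) (F : Fin m) :
    ∃ v ∈ V, pairing (n F) v = -(h F : ℝ) := by
  by_contra! hne
  obtain ⟨q, hqF, hq⟩ := hF.exists_relint_point hfull F
  have hsub : convexHull ℝ V ⊆ pairingLin (n F) ⁻¹' Ioi (-(h F : ℝ)) := by
    refine convexHull_min (fun v hv => ?_) ((convex_Ioi _).linear_preimage _)
    have hvP := subset_convexHull ℝ V hv
    rw [hF.1] at hvP
    rw [mem_preimage, ← pairing_eq_pairingLin]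
    exact lt_of_le_of_ne (hvP F) (hne v hv).symm
  have hqP : q ∈ convexHull ℝ V := by
    rw [hF.1]
    intro G
    by_cases hG : G = F
    · rw [hG, hqF]
    · exact (hq G hG).le
  have := hsub hqP
  rw [mem_preimage, ← pairing_eq_pairingLin, hqF] at this
  exact lt_irrefl _ (mem_Ioi.mp this)

/-- The nearly Gorenstein condition for the lattice points at height one of the cone. -/
lemma NGIncl.exists_decomposition (hng : NGIncl n h) {v : Fin d → ℝ} (hv : v ∈ latticePoints d)
    (hvP : ∀ F, pairing (n F) v ≥ -(h F : ℝ)) :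
    ∃ k : ℤ, ∃ u ∈ latticePoints d, ∃ w ∈ latticePoints d, v = u + w ∧
      (∀ F, -((k : ℝ) * h F) + 1 ≤ pairing (n F) u) ∧
      (∀ F, ((k : ℝ) - 1) * h F - 1 ≤ pairing (n F) w) := by
  have hmem : ((v, 1) : (Fin d → ℝ) × ℝ) ∈ (coneOver n h ∩ latticePairs d) \ {0} := by
    refine ⟨⟨fun F => by simpa using hvP F, hv, 1, by simp⟩, fun h0 => ?_⟩
    exact one_ne_zero (congrArg Prod.snd (mem_singleton_iff.mp h0))
  obtain ⟨⟨u, k⟩, ⟨hu, hul, k', hk⟩, ⟨w, l⟩, ⟨hw, hwl, -⟩, hsum⟩ := hng hmem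
  obtain ⟨huw, hkl⟩ := Prod.mk.inj hsum
  simp only at hk hkl huw
  subst hk
  refine ⟨k', u, hul, w, hwl, huw.symm, fun F => ?_, fun F => ?_⟩
  · have h1 := hu F
    obtain ⟨z, hz⟩ := pairing_mem_int (n F) hul
    simp only [hz, gt_iff_lt] at h1 ⊢
    exact_mod_cast h1
  · have h1 := hw F
    obtain rfl : l = 1 - k' := by linarith
    simp only at h1
    linarith

end Facets

/-- Coordinates that are not separated by any product decomposition of `P`. -/
def inseparable {ι : Type*} (P : Set (ι → ℝ)) : Setoid ι where
  r i j := ∀ I, SplitsAlong P I → (i ∈ I ↔ j ∈ I)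
  iseqv := ⟨fun _ _ _ => Iff.rfl, fun h I hI => (h I hI).symm,
    fun h h' I hI => (h I hI).trans (h' I hI)⟩

lemma exists_sigma_equiv_of_setoid {d : ℕ} (r : Setoid (Fin d)) :
    ∃ (s : ℕ) (dims : Fin s → ℕ) (e : Fin d ≃ (Σ i : Fin s, Fin (dims i))),
      (∀ i, 1 ≤ dims i) ∧ ∀ i j, (e i).1 = (e j).1 ↔ r i j := by
  classical
  let f : Fin d → Fin (Fintype.card (Quotient r)) := fun i =>
    Fintype.equivFin (Quotient r) (Quotient.mk r i)
  refine ⟨Fintype.card (Quotient r), fun q => Fintype.card {i // f i = q},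
    (Equiv.sigmaFiberEquiv f).symm.trans
      (Equiv.sigmaCongrRight fun q => Fintype.equivFin {i // f i = q}), fun q => ?_, fun i j => ?_⟩
  · obtain ⟨i, hi⟩ := Quotient.exists_rep ((Fintype.equivFin (Quotient r)).symm q)
    exact Fintype.card_pos_iff.mpr ⟨⟨i, by simp [f, hi]⟩⟩
  · change f i = f j ↔ _
    rw [(Fintype.equivFin (Quotient r)).injective.eq_iff]
    exact Quotient.eq

section Blocks

variable {d s : ℕ} {dims : Fin s → ℕ}

/-- The projection of `ℝ^d` to the coordinates of one block. -/
def blockProj (e : Fin d ≃ (Σ i : Fin s, Fin (dims i))) (b : Fin s) :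
    (Fin d → ℝ) →ₗ[ℝ] (Fin (dims b) → ℝ) :=
  LinearMap.funLeft ℝ ℝ fun j => e.symm ⟨b, j⟩

lemma blockProj_apply (e : Fin d ≃ (Σ i : Fin s, Fin (dims i))) (b : Fin s) (x : Fin d → ℝ)
    (j : Fin (dims b)) : blockProj e b x j = x (e.symm ⟨b, j⟩) := rfl

lemma blockProj_surjective (e : Fin d ≃ (Σ i : Fin s, Fin (dims i))) (b : Fin s) :
    Function.Surjective (blockProj e b) :=
  LinearMap.funLeft_surjective_of_injective ℝ ℝ _
    (e.symm.injective.comp sigma_mk_injective)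

lemma blockProj_mem_latticePoints (e : Fin d ≃ (Σ i : Fin s, Fin (dims i))) (b : Fin s)
    {x : Fin d → ℝ} (hx : x ∈ latticePoints d) : blockProj e b x ∈ latticePoints (dims b) :=
  fun _ => hx _

lemma pairing_blockProj (e : Fin d ≃ (Σ i : Fin s, Fin (dims i))) (b : Fin s) {n : Fin d → ℤ}
    (hn : ∀ i, (e i).1 ≠ b → n i = 0) (x : Fin d → ℝ) :
    pairing (fun j => n (e.symm ⟨b, j⟩)) (blockProj e b x) = pairing n x := by
  unfold pairing
  rw [← e.symm.sum_comp, Fintype.sum_sigma, Finset.sum_eq_single b]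
  · rfl
  · intro c _ hc
    exact Finset.sum_eq_zero fun j _ => by simp [hn (e.symm ⟨c, j⟩) (by simpa using hc)]
  · simp

lemma sum_image_blocks (Q : ∀ i : Fin s, Set (Fin (dims i) → ℝ)) :
    {y : (Σ i : Fin s, Fin (dims i)) → ℝ | ∀ i, (fun j => y ⟨i, j⟩) ∈ Q i} =
      ∑ i : Fin s,
        (fun (v : Fin (dims i) → ℝ) (p : Σ j : Fin s, Fin (dims j)) =>
          if hp : p.1 = i then v (Fin.cast (congrArg dims hp) p.2) else 0) '' Q i := by
  have hval : ∀ (g : ∀ i : Fin s, Fin (dims i) → ℝ) (p : Σ j : Fin s, Fin (dims j)),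
      (∑ i, fun (p : Σ j : Fin s, Fin (dims j)) =>
        if hp : p.1 = i then g i (Fin.cast (congrArg dims hp) p.2) else 0) p = g p.1 p.2 := by
    intro g p
    rw [Finset.sum_apply, Finset.sum_eq_single p.1]
    · simp
    · intro b _ hb
      rw [dif_neg (Ne.symm hb)]
    · simp
  ext y
  rw [Set.mem_fintype_sum]
  constructor
  · intro hy
    refine ⟨_, fun i => mem_image_of_mem _ (hy i), ?_⟩
    funext p
    exact hval (fun i j => y ⟨i, j⟩) p
  · rintro ⟨g, hg, rfl⟩ i
    choose v hv hvg using hg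
    obtain rfl := funext hvg
    convert hv i using 1
    funext j
    exact hval v ⟨i, j⟩

end Blocks

theorem stmt_19 {d : ℕ} (hd : 1 ≤ d) (P : Set (Fin d → ℝ))
    (hP : Is01Polytope P) (hfull : (interior P).Nonempty) (hidp : IsIDP P)
    (hng : NearlyGorenstein P) :
    ∃ (s : ℕ) (dims : Fin s → ℕ) (e : Fin d ≃ (Σ i : Fin s, Fin (dims i)))
      (Q : ∀ i : Fin s, Set (Fin (dims i) → ℝ)),
      1 ≤ s ∧ (∀ i, 1 ≤ dims i) ∧ (∑ i, dims i = d) ∧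
      (∀ i, Is01Polytope (Q i) ∧ (interior (Q i)).Nonempty ∧
        IsGorenstein (Q i)) ∧
      (fun (x : Fin d → ℝ) => x ∘ e.symm) '' P =
        {y : (Σ i : Fin s, Fin (dims i)) → ℝ | ∀ i, (fun j => y ⟨i, j⟩) ∈ Q i} ∧
      (fun (x : Fin d → ℝ) => x ∘ e.symm) '' P =
        ∑ i : Fin s,
          (fun (v : Fin (dims i) → ℝ) (p : Σ j : Fin s, Fin (dims j)) =>
            if hp : p.1 = i then v (Fin.cast (congrArg dims hp) p.2) else 0) '' Q i := by
  classical
  obtain ⟨V, h01, rfl⟩ := hP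
  obtain ⟨m, n, h, hF, hNG⟩ := hng
  have hne : V.Nonempty := by
    obtain ⟨p, hp⟩ := hfull
    exact_mod_cast convexHull_nonempty_iff.mp ⟨p, interior_subset hp⟩
  obtain ⟨s, dims, e, hdims, he⟩ :=
    exists_sigma_equiv_of_setoid (inseparable (convexHull ℝ (V : Set (Fin d → ℝ))))
  have hsupp : ∀ F, ∃ b, ∀ i, (e i).1 ≠ b → n F i = 0 := by
    intro F
    obtain ⟨i, hi⟩ := hF.exists_normal_ne_zero F
    refine ⟨(e i).1, fun j hj => ?_⟩
    by_contra hnj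
    refine hj ((he j i).mpr fun I hI => ⟨fun hjI => ?_, fun hiI => ?_⟩)
    · by_contra hiI
      exact hi (hF.normal_eq_zero_of_splitsAlong hfull hI hjI hiI hnj)
    · by_contra hjI
      exact hnj (hF.normal_eq_zero_of_splitsAlong hfull hI hiI hjI hi)
  have hprod : ∀ x : Fin d → ℝ,
      (∀ b, blockProj e b x ∈ blockProj e b '' convexHull ℝ (V : Set (Fin d → ℝ))) →
      x ∈ convexHull ℝ (V : Set (Fin d → ℝ)) := by
    intro x hx
    rw [hF.1]
    intro F
    obtain ⟨b, hb⟩ := hsupp F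
    obtain ⟨y, hy, hyx⟩ := hx b
    rw [hF.1] at hy
    rw [← pairing_blockProj e b hb, ← hyx, pairing_blockProj e b hb]
    exact hy F
  have hblock : ∀ b, Is01Polytope (blockProj e b '' convexHull ℝ (V : Set (Fin d → ℝ))) ∧
      (interior (blockProj e b '' convexHull ℝ (V : Set (Fin d → ℝ)))).Nonempty ∧
      IsGorenstein (blockProj e b '' convexHull ℝ (V : Set (Fin d → ℝ))) := by
    intro b
    have himage : blockProj e b '' convexHull ℝ (V : Set (Fin d → ℝ)) =
        convexHull ℝ (V.image (blockProj e b) : Finset (Fin (dims b) → ℝ)) := by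
      rw [LinearMap.image_convexHull, Finset.coe_image]
    have h01b : ∀ v ∈ V.image (blockProj e b), ∀ i, v i = 0 ∨ v i = 1 := by
      intro v hv i
      obtain ⟨v', hv', rfl⟩ := Finset.mem_image.mp hv
      exact h01 v' hv' _
    refine ⟨⟨_, h01b, himage⟩, ?_, ?_⟩
    · exact (hfull.image _).mono ((LinearMap.isOpenMap_of_finiteDimensional _
        (blockProj_surjective e b)).image_interior_subset _)
    let κ := {F : Fin m // ∀ i, (e i).1 ≠ b → n F i = 0}
    let nb : κ → Fin (dims b) → ℤ := fun F j => n F.1 (e.symm ⟨b, j⟩)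
    have hpair : ∀ (F : κ) x, pairing (nb F) (blockProj e b x) = pairing (n F.1) x :=
      fun F x => pairing_blockProj e b F.2 x
    have hPb : blockProj e b '' convexHull ℝ (V : Set (Fin d → ℝ)) =
        {x | ∀ F : κ, pairing (nb F) x ≥ -(h F.1 : ℝ)} := by
      refine Subset.antisymm ?_ fun x hx => ?_
      · rintro _ ⟨y, hy, rfl⟩ F
        rw [hF.1] at hy
        rw [hpair]
        exact hy F.1
      · obtain ⟨x, rfl⟩ := blockProj_surjective e b x
        obtain ⟨p, hp⟩ := hne
        have hpP := subset_convexHull ℝ (V : Set (Fin d → ℝ)) hp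
        let y : Fin d → ℝ := fun i => if (e i).1 = b then x i else p i
        have hyx : blockProj e b y = blockProj e b x := by
          funext j
          simp [blockProj_apply, y]
        refine ⟨y, ?_, hyx⟩
        rw [hF.1] at hpP ⊢
        intro F
        obtain ⟨c, hc⟩ := hsupp F
        by_cases hcb : c = b
        · subst hcb
          rw [← pairing_blockProj e c hc, hyx]
          exact hx ⟨F, hc⟩
        · have hyp : blockProj e c y = blockProj e c p := by
            funext j
            simp [blockProj_apply, y, hcb]
          rw [← pairing_blockProj e c hc, hyp, pairing_blockProj e c hc]
          exact hpP F
    rw [himage] at hPb ⊢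
    have hneb : (V.image (blockProj e b)).Nonempty := hne.image _
    obtain ⟨a, ha, u, hu, hau⟩ := exists_height_one_point (n := nb) (h := fun F => h F.1)
      (V := (V.image (blockProj e b) : Finset (Fin (dims b) → ℝ))) (hdims b)
      (by exact_mod_cast h01b) (by exact_mod_cast hneb) hPb
      (fun F => by
        obtain ⟨v, hv, hFv⟩ := hF.exists_vertex_mem_facet hfull F.1
        exact ⟨_, Finset.mem_coe.mpr (Finset.mem_image_of_mem _ hv), by rw [hpair, hFv]⟩)
      (fun x hx => by
        obtain ⟨v, hv, rfl⟩ := Finset.mem_image.mp (Finset.mem_coe.mp hx)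
        have hvP := subset_convexHull ℝ (V : Set (Fin d → ℝ)) hv
        rw [hF.1] at hvP
        obtain ⟨k, u, hu, w, hw, huw, hku, hkw⟩ :=
          hNG.exists_decomposition (mem_latticePoints_of_zero_one (h01 v hv)) hvP
        refine ⟨k, blockProj e b u, blockProj_mem_latticePoints e b hu, blockProj e b w,
          blockProj_mem_latticePoints e b hw, by rw [huw, map_add], fun F => ?_, fun F => ?_⟩
        · rw [hpair]
          exact hku F.1
        · rw [hpair]
          exact hkw F.1)
      (fun J hJ => by
        rw [← himage] at hJ
        have hsplit : SplitsAlong (convexHull ℝ (V : Set (Fin d → ℝ)))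
            ((fun j => e.symm ⟨b, j⟩) '' J) := by
          intro x hx y hy z hzx hzy
          refine hprod z fun c => ?_
          by_cases hcb : c = b
          · subst hcb
            refine hJ _ (mem_image_of_mem _ hx) _ (mem_image_of_mem _ hy) _
              (fun j hj => hzx _ (mem_image_of_mem _ hj)) (fun j hj => hzy _ ?_)
            rintro ⟨j', hj', hjj'⟩
            obtain rfl : j' = j := (e.symm.injective.comp sigma_mk_injective) hjj'
            exact hj hj'
          · refine ⟨y, hy, ?_⟩
            funext j
            refine (hzy _ ?_).symm
            rintro ⟨j', -, hjj'⟩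
            exact hcb (congrArg Sigma.fst (e.symm.injective hjj')).symm
        have hiff : ∀ j j', j ∈ J ↔ j' ∈ J := by
          have hmem : ∀ j, e.symm ⟨b, j⟩ ∈ (fun j => e.symm ⟨b, j⟩) '' J ↔ j ∈ J := fun j =>
            (e.symm.injective.comp sigma_mk_injective).mem_set_image
          intro j j'
          rw [← hmem j, ← hmem j']
          exact (he _ _).mp (by simp) _ hsplit
        rcases J.eq_empty_or_nonempty with hJ | ⟨j, hj⟩
        · exact Or.inl hJ
        · exact Or.inr (eq_univ_of_forall fun j' => (hiff j j').mp hj))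
    exact isGorenstein_of_height_one_point (hdims b) h01b hneb hPb ha hu hau
  have himg : (fun (x : Fin d → ℝ) => x ∘ e.symm) '' convexHull ℝ (V : Set (Fin d → ℝ)) =
      {y | ∀ b, (fun j => y ⟨b, j⟩) ∈ blockProj e b '' convexHull ℝ (V : Set (Fin d → ℝ))} := by
    refine Subset.antisymm ?_ fun y hy => ⟨y ∘ e, hprod _ fun b => ?_, ?_⟩
    · rintro _ ⟨x, hx, rfl⟩ b
      exact mem_image_of_mem _ hx
    · convert hy b using 1
      funext j
      simp [blockProj_apply]
    · funext p
      simp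
  refine ⟨s, dims, e, fun b => blockProj e b '' convexHull ℝ (V : Set (Fin d → ℝ)), ?_, hdims,
    ?_, hblock, himg, himg.trans (sum_image_blocks _)⟩
  · exact Nat.one_le_iff_ne_zero.mpr fun hs => by
      subst hs
      exact (e ⟨0, hd⟩).1.elim0
  · simpa using (Fintype.card_congr e).symm
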